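/- Let μ be a distribution on Q_d that is monotone decreasing, i.e. μ(X) ≥ μ(Y) whenever X ⊆ Y (meaning x_i ≤ y_i for all i). Then (𝟎,𝟎) is an equilibrium for the two-player Voronoi game on Q_d with distribution μ. -/

import Mathlib

open Finset

/-- Hamming distance on the hypercube `{0,1}^d` (modelled as `Fin d → Bool`). -/
def hamming {d : ℕ} (X Y : Fin d → Bool) : ℕ :=
  (Finset.univ.filter (fun i => X i ≠ Y i)).card

/-- Number of 1-coordinates of a point of the hypercube. -/
def nOnes {d : ℕ} (X : Fin d → Bool) : ℕ :=
  (Finset.univ.filter (fun i => X i = true)).card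

/-- `μ` is a probability distribution on the hypercube. -/
def IsDistribution {d : ℕ} (μ : (Fin d → Bool) → ℝ) : Prop :=
  (∀ X, 0 ≤ μ X) ∧ ∑ X : Fin d → Bool, μ X = 1

open Classical in
/-- The weight of a set of points under `μ`. -/
noncomputable def wt {d : ℕ} (μ : (Fin d → Bool) → ℝ) (S : Set (Fin d → Bool)) : ℝ :=
  ∑ X : Fin d → Bool, if X ∈ S then μ X else 0

/-- Payoff to player 1, positioned at `A`, against player 2 positioned at `B`. -/
noncomputable def P1 {d : ℕ} (μ : (Fin d → Bool) → ℝ) (A B : Fin d → Bool) : ℝ :=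
  wt μ {X | hamming X A < hamming X B} + (1/2) * wt μ {X | hamming X A = hamming X B}

/-- Payoff to player 2, positioned at `B`, against player 1 positioned at `A`. -/
noncomputable def P2 {d : ℕ} (μ : (Fin d → Bool) → ℝ) (A B : Fin d → Bool) : ℝ :=
  wt μ {X | hamming X B < hamming X A} + (1/2) * wt μ {X | hamming X A = hamming X B}

/-- `(A,B)` is an equilibrium: neither player can strictly improve by moving. -/
def IsEquilibrium {d : ℕ} (μ : (Fin d → Bool) → ℝ) (A B : Fin d → Bool) : Prop :=
  (∀ A', P1 μ A' B ≤ P1 μ A B) ∧ (∀ B', P2 μ A B' ≤ P2 μ A B)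

/-- `w_i^0`: the weight of the subcube where coordinate `i` equals 0. -/
noncomputable def w0 {d : ℕ} (μ : (Fin d → Bool) → ℝ) (i : Fin d) : ℝ :=
  wt μ {X | X i = false}

/-- The all-zeros point `𝟎`. -/
def zeroPt (d : ℕ) : Fin d → Bool := fun _ => false

/-- The all-ones point `𝟏`. -/
def onePt (d : ℕ) : Fin d → Bool := fun _ => true

/-- The share of the voter `X` won by a player at `A` against a player at `B`. -/
noncomputable def share {d : ℕ} (A B X : Fin d → Bool) : ℝ :=
  if hamming X A < hamming X B then 1 else if hamming X A = hamming X B then 1 / 2 else 0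

lemma P1_eq_sum_mul_share {d : ℕ} (μ : (Fin d → Bool) → ℝ) (A B : Fin d → Bool) :
    P1 μ A B = ∑ X, μ X * share A B X := by
  unfold P1 wt
  rw [Finset.mul_sum, ← Finset.sum_add_distrib]
  refine Finset.sum_congr rfl fun X _ => ?_
  simp only [Set.mem_ofPred_eq, share]
  split_ifs <;> first | omega | ring

lemma P2_eq_P1_swap {d : ℕ} (μ : (Fin d → Bool) → ℝ) (A B : Fin d → Bool) :
    P2 μ A B = P1 μ B A := by
  simp only [P1, P2, eq_comm]

lemma share_nonneg {d : ℕ} (A B X : Fin d → Bool) : 0 ≤ share A B X := by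
  unfold share
  split_ifs <;> norm_num

lemma share_add_share_swap {d : ℕ} (A B X : Fin d → Bool) :
    share A B X + share B A X = 1 := by
  unfold share
  split_ifs <;> first | omega | norm_num

lemma hamming_add_hamming_zeroPt_le {d : ℕ} (A : Fin d → Bool) {X Y : Fin d → Bool}
    (h : X ≤ Y) :
    hamming Y A + hamming X (zeroPt d) ≤ hamming X A + hamming Y (zeroPt d) := by
  simp only [hamming, Finset.card_filter, ← Finset.sum_add_distrib]
  refine Finset.sum_le_sum fun i _ => ?_
  have hi := h i
  revert hi
  simp only [zeroPt]
  cases X i <;> cases Y i <;> cases A i <;> simp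

lemma share_zeroPt_monotone {d : ℕ} (A : Fin d → Bool) : Monotone (share A (zeroPt d)) := by
  intro X Y h
  have := hamming_add_hamming_zeroPt_le A h
  unfold share
  split_ifs <;> first | omega | norm_num

lemma sum_share_zeroPt {d : ℕ} (A : Fin d → Bool) :
    ∑ X, share A (zeroPt d) X = Fintype.card (Fin d → Bool) / 2 := by
  let φ : (Fin d → Bool) → (Fin d → Bool) := fun X i => xor (X i) (A i)
  have hφ : Function.Involutive φ := fun X => by ext i; simp [φ]
  have hA (X) : hamming (φ X) A = hamming X (zeroPt d) := by
    refine congrArg Finset.card (Finset.filter_congr fun i _ => ?_)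
    simp only [φ, zeroPt]
    generalize X i = x
    generalize A i = a
    revert x a
    decide
  have h0 (X) : hamming (φ X) (zeroPt d) = hamming X A := by
    rw [← hA (φ X), hφ X]
  have hswap : ∑ X, share A (zeroPt d) X = ∑ X, share (zeroPt d) A X := by
    rw [← Equiv.sum_comp hφ.toPerm]
    simp [share, hA, h0]
  have hsum : ∑ X, (share A (zeroPt d) X + share (zeroPt d) A X) =
      Fintype.card (Fin d → Bool) := by
    simp [share_add_share_swap]
  rw [Finset.sum_add_distrib, ← hswap] at hsum
  linarith

lemma P1_self {d : ℕ} {μ : (Fin d → Bool) → ℝ} (hμ : ∑ X, μ X = 1) (A : Fin d → Bool) :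
    P1 μ A A = 1 / 2 := by
  simp [P1, wt, hμ]

/-- The FKG inequality bounds the payoff of any position against `𝟎`. -/
lemma P1_zeroPt_le {d : ℕ} {μ : (Fin d → Bool) → ℝ} (hμ : ∑ X, μ X = 1) (hanti : Antitone μ)
    (A : Fin d → Bool) : P1 μ A (zeroPt d) ≤ 1 / 2 := by
  have hfkg := fkg (μ := fun _ : Fin d → Bool => (1 : ℝ))
    (f := fun X => μ ⊥ - μ X) (g := share A (zeroPt d))
    (fun _ => zero_le_one) (fun X => sub_nonneg.2 (hanti bot_le)) (share_nonneg A _)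
    (fun X Y h => sub_le_sub_left (hanti h) _) (share_zeroPt_monotone A) (by simp)
  simp only [one_mul, sub_mul, Finset.sum_sub_distrib, ← Finset.mul_sum, hμ, sum_share_zeroPt,
    ← P1_eq_sum_mul_share, Finset.sum_const, Finset.card_univ, nsmul_eq_mul, mul_one] at hfkg
  have hcard : (0 : ℝ) < Fintype.card (Fin d → Bool) := by exact_mod_cast Fintype.card_pos
  nlinarith

theorem statement_13 (d : ℕ) (μ : (Fin d → Bool) → ℝ) (hμ : IsDistribution μ)
    (hmono : ∀ X Y : Fin d → Bool, (∀ i, X i ≤ Y i) → μ Y ≤ μ X) :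
    IsEquilibrium μ (zeroPt d) (zeroPt d) := by
  have hle (A : Fin d → Bool) : P1 μ A (zeroPt d) ≤ P1 μ (zeroPt d) (zeroPt d) := by
    rw [P1_self hμ.2]
    exact P1_zeroPt_le hμ.2 (fun X Y h => hmono X Y h) A
  refine ⟨hle, fun B => ?_⟩
  rw [P2_eq_P1_swap, P2_eq_P1_swap]
  exact hle B
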